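/- Let G = G_{3,n} = S_3 □ P_n with n even. Then (3n²)/2 + n − 1 ≤ rn(G) ≤ (3n²)/2 + n. -/

import Mathlib

/-- The star graph on `m` vertices with center `0`. -/
def starGraph (m : ℕ) : SimpleGraph (Fin m) :=
  SimpleGraph.fromRel (fun a _ => (a : ℕ) = 0)

/-- The path graph on `n` vertices `0, 1, …, n-1`. -/
def pathGraph' (n : ℕ) : SimpleGraph (Fin n) :=
  SimpleGraph.fromRel (fun a b => (a : ℕ) + 1 = b)

/-- The stacked-book graph `G_{m,n} = S_m □ P_n`. -/
def bookGraph (m n : ℕ) : SimpleGraph (Fin m × Fin n) :=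
  (starGraph m).boxProd (pathGraph' n)

/-- `f` is a radio labeling of `G` for diameter `D`:
`|f u - f v| ≥ D + 1 - d(u,v)` for all distinct `u, v`. -/
def IsRadioLabeling {V : Type*} (G : SimpleGraph V) (D : ℕ) (f : V → ℕ) : Prop :=
  ∀ u v : V, u ≠ v → (D : ℤ) + 1 - G.dist u v ≤ |(f u : ℤ) - (f v : ℤ)|

/-- The span of a labeling: maximum label minus minimum label. -/
noncomputable def span {V : Type*} (f : V → ℕ) : ℕ :=
  sSup (Set.range f) - sInf (Set.range f)

/-- The radio number of the stacked-book graph `G_{m,n}` (whose diameter is `n+1`). -/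
noncomputable def rnBook (m n : ℕ) : ℕ :=
  sInf {s | ∃ f : Fin m × Fin n → ℕ, IsRadioLabeling (bookGraph m n) (n + 1) f ∧ span f = s}

/-- The distance between two vertices of the star graph with center `0`. -/
def starDist (a b : ℕ) : ℕ :=
  if a = b then 0 else if a = 0 ∨ b = 0 then 1 else 2

/-- The distance between two vertices of the stacked-book graph. -/
def bookDist {m n : ℕ} (u v : Fin m × Fin n) : ℕ :=
  starDist u.1 v.1 + (((u.2 : ℕ) - v.2) + ((v.2 : ℕ) - u.2))

theorem bookGraph_adj_iff {m n : ℕ} (u v : Fin m × Fin n) :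
    (bookGraph m n).Adj u v ↔
      ((u.1 : ℕ) ≠ v.1 ∧ ((u.1 : ℕ) = 0 ∨ (v.1 : ℕ) = 0)) ∧ (u.2 : ℕ) = v.2 ∨
      ((u.2 : ℕ) + 1 = v.2 ∨ (v.2 : ℕ) + 1 = u.2) ∧ (u.1 : ℕ) = v.1 := by
  simp only [bookGraph, SimpleGraph.boxProd_adj, starGraph, pathGraph', SimpleGraph.fromRel_adj,
    ne_eq, Fin.ext_iff]
  omega

theorem bookDist_le_length {m n : ℕ} {u v : Fin m × Fin n} (p : (bookGraph m n).Walk u v) :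
    bookDist u v ≤ p.length := by
  induction p with
  | nil => simp [bookDist, starDist]
  | cons h p ih =>
    rw [bookGraph_adj_iff] at h
    rw [SimpleGraph.Walk.length_cons]
    simp only [bookDist, starDist] at ih ⊢
    split_ifs at ih ⊢ <;> omega

theorem exists_adj_bookDist {m n : ℕ} (u v : Fin m × Fin n) (d : ℕ) (h : bookDist u v = d + 1) :
    ∃ w, (bookGraph m n).Adj u w ∧ bookDist w v = d := by
  obtain ⟨⟨a, ha⟩, ⟨x, hx⟩⟩ := u
  obtain ⟨⟨b, hb⟩, ⟨y, hy⟩⟩ := v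
  simp only [bookDist, starDist] at h
  rcases lt_trichotomy x y with hxy | hxy | hxy
  · refine ⟨(⟨a, ha⟩, ⟨x + 1, by omega⟩), ?_, ?_⟩
    · rw [bookGraph_adj_iff]; simp
    · simp only [bookDist, starDist]; split_ifs at h ⊢ <;> omega
  · by_cases hab : a = 0 ∨ b = 0
    · refine ⟨(⟨b, hb⟩, ⟨x, hx⟩), ?_, ?_⟩
      · rw [bookGraph_adj_iff]; left; grind
      · simp only [bookDist, starDist]; split_ifs at h ⊢ <;> omega
    · refine ⟨(⟨0, by omega⟩, ⟨x, hx⟩), ?_, ?_⟩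
      · rw [bookGraph_adj_iff]; left; grind
      · simp only [bookDist, starDist]; grind
  · refine ⟨(⟨a, ha⟩, ⟨x - 1, by omega⟩), ?_, ?_⟩
    · rw [bookGraph_adj_iff]; right; grind
    · simp only [bookDist, starDist]; grind

theorem eq_of_bookDist_eq_zero {m n : ℕ} {u v : Fin m × Fin n} (h : bookDist u v = 0) :
    u = v := by
  simp only [bookDist, starDist] at h
  ext <;> split_ifs at h <;> omega

theorem exists_walk_length_eq_bookDist {m n : ℕ} (u v : Fin m × Fin n) :
    ∃ p : (bookGraph m n).Walk u v, p.length = bookDist u v := by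
  induction hd : bookDist u v generalizing u with
  | zero =>
    obtain rfl := eq_of_bookDist_eq_zero hd
    exact ⟨.nil, rfl⟩
  | succ d ih =>
    obtain ⟨w, huw, hw⟩ := exists_adj_bookDist u v d hd
    obtain ⟨p, hp⟩ := ih w hw
    exact ⟨.cons huw p, by simp [hp]⟩

theorem bookGraph_dist {m n : ℕ} (u v : Fin m × Fin n) :
    (bookGraph m n).dist u v = bookDist u v := by
  obtain ⟨p, hp⟩ := exists_walk_length_eq_bookDist u v
  apply le_antisymm
  · exact hp ▸ SimpleGraph.dist_le p
  · obtain ⟨q, hq⟩ := p.reachable.exists_walk_length_eq_dist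
    exact hq ▸ bookDist_le_length q

/-- If distances are bounded by half the sum of vertex weights `w`, then labels of a radio labeling
spread over any nonempty set of vertices at least as far as the weights force. -/
theorem exists_spread_of_isRadioLabeling {V : Type*} [DecidableEq V] {G : SimpleGraph V} {D : ℕ}
    {f : V → ℕ} (hf : IsRadioLabeling G D f) (w : V → ℤ)
    (hw : ∀ u v, u ≠ v → 2 * (G.dist u v : ℤ) ≤ w u + w v) (s : Finset V) (hs : s.Nonempty) :
    ∃ a ∈ s, ∃ b ∈ s, (∀ v ∈ s, f v ≤ f b) ∧
      2 * ((s.card : ℤ) - 1) * (D + 1) + w a + w b ≤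
        2 * ((f b : ℤ) - f a) + 2 * ∑ v ∈ s, w v := by
  induction s using Finset.induction_on_max_value f with
  | empty => simp at hs
  | insert c s hc hmax ih =>
    rcases s.eq_empty_or_nonempty with rfl | hs'
    · exact ⟨c, by simp, c, by simp, by simp, by simp; linarith⟩
    · obtain ⟨a, ha, b, hb, -, h⟩ := ih hs'
      refine ⟨a, by simp [ha], c, by simp, ?_, ?_⟩
      · intro v hv
        rcases Finset.mem_insert.mp hv with rfl | hv
        exacts [le_rfl, hmax v hv]
      · have hcb : c ≠ b := fun h => hc (h ▸ hb)
        have h1 := hf c b hcb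
        have h2 := hw c b hcb
        have h3 := hmax b hb
        rw [abs_of_nonneg (by omega)] at h1
        rw [Finset.sum_insert hc, Finset.card_insert_of_notMem hc]
        push_cast
        linarith

/-- Twice the distance from a vertex to the center of the stacked-book graph. -/
def bookWeight {m n : ℕ} (v : Fin m × Fin n) : ℤ :=
  2 * (starDist v.1 0 : ℤ) + |2 * (v.2 : ℤ) - (n - 1)|

theorem two_mul_bookDist_le {m n : ℕ} (u v : Fin m × Fin n) :
    2 * (bookDist u v : ℤ) ≤ bookWeight u + bookWeight v := by
  have hs : starDist u.1 v.1 ≤ starDist u.1 0 + starDist v.1 0 := by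
    simp only [starDist]; split_ifs <;> omega
  simp only [bookDist, bookWeight]
  grind

theorem one_le_bookWeight {m n : ℕ} (hn : Even n) (v : Fin m × Fin n) : 1 ≤ bookWeight v := by
  obtain ⟨k, rfl⟩ := hn
  simp only [bookWeight]
  push_cast
  grind

theorem sum_range_abs_two_mul_sub (k : ℕ) :
    ∑ x ∈ Finset.range (k + k), |2 * (x : ℤ) - ((k + k : ℕ) - 1)| = 2 * k ^ 2 := by
  rw [Finset.sum_range_add]
  have h (j : ℕ) : ∑ x ∈ Finset.range j, (2 * (x : ℤ) + 1) = j ^ 2 := by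
    induction j with
    | zero => simp
    | succ j ih => rw [Finset.sum_range_succ, ih]; push_cast; ring
  rw [← Finset.sum_range_reflect, two_mul, ← h]
  congr 1 <;> refine Finset.sum_congr rfl fun x hx => ?_ <;> rw [Finset.mem_range] at hx <;> grind

theorem sum_bookWeight (k : ℕ) :
    ∑ v : Fin 3 × Fin (k + k), bookWeight v = 6 * (k : ℤ) ^ 2 + 8 * k := by
  have h := sum_range_abs_two_mul_sub k
  rw [Finset.sum_range] at h
  rw [Fintype.sum_prod_type]
  simp only [bookWeight, Finset.sum_add_distrib, h]
  simp [Fin.sum_univ_three, starDist]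
  ring

theorem le_span {V : Type*} [Finite V] (f : V → ℕ) (a b : V) : f b - f a ≤ span f := by
  have h1 : f b ≤ sSup (Set.range f) := le_csSup (Set.finite_range f).bddAbove ⟨b, rfl⟩
  have h2 : sInf (Set.range f) ≤ f a := Nat.sInf_le ⟨a, rfl⟩
  unfold span
  omega

theorem span_le {V : Type*} [Nonempty V] (f : V → ℕ) (B : ℕ) (h : ∀ v, f v ≤ B) : span f ≤ B := by
  have : sSup (Set.range f) ≤ B := csSup_le (Set.range_nonempty f) (by rintro _ ⟨v, rfl⟩; exact h v)
  unfold span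
  omega

theorem le_span_of_isRadioLabeling {k : ℕ} (hk : 1 ≤ k) {f : Fin 3 × Fin (k + k) → ℕ}
    (hf : IsRadioLabeling (bookGraph 3 (k + k)) (k + k + 1) f) :
    6 * k ^ 2 + 2 * k - 1 ≤ span f := by
  have hn : Even (k + k) := ⟨k, rfl⟩
  obtain ⟨a, -, b, -, -, h⟩ := exists_spread_of_isRadioLabeling hf bookWeight
    (fun u v _ => by rw [bookGraph_dist]; exact two_mul_bookDist_le u v) Finset.univ
    ⟨(0, ⟨0, by omega⟩), Finset.mem_univ _⟩
  have ha := one_le_bookWeight hn a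
  have hb := one_le_bookWeight hn b
  have hspan := le_span f a b
  rw [sum_bookWeight] at h
  simp only [Finset.card_univ, Fintype.card_prod, Fintype.card_fin] at h
  push_cast at h
  have : 6 * (k : ℤ) ^ 2 + 2 * k - 1 ≤ (f b : ℤ) - f a := by nlinarith
  zify [show 1 ≤ 6 * k ^ 2 + 2 * k by omega]
  omega

/-- The vertex in layer `s` and column `x` of the stacked book with `2 * k` columns is visited in
round `r`, at step `2 * m + e` of that round; `h` counts the steps along the cycle of layers. Even
steps go through the left half of the columns from the middle outwards, odd steps through the right
half from the end inwards. -/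
def IsBookPosition (k s x r m e h : ℕ) : Prop :=
  r < 3 ∧ m < k ∧ e < 2 ∧ s = h % 3 ∧ x + m + 1 = k + k * e ∧
    h + (if k % 3 = 0 then (3 - r) % 3 else 0) = 2 * m + e + 2 * k * r

/-- The label of a vertex visited at the given position. -/
def bookLabel (k r m e h : ℕ) : ℤ :=
  2 * (k * k) * r + m * (2 * k - 1) + k * e + (h - (h + 1) / 3)

theorem exists_isBookPosition {k s x : ℕ} (hs : s < 3) (hx : x < k + k) :
    ∃ r m e h, IsBookPosition k s x r m e h := by
  have key (j : ℕ) : ∃ r h, r < 3 ∧ s = h % 3 ∧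
      h + (if k % 3 = 0 then (3 - r) % 3 else 0) = j + 2 * k * r := by
    by_contra! hc
    have h0 := hc 0 j (by omega)
    have h1 := hc 1 (j + 2 * k - if k % 3 = 0 then 2 else 0) (by omega)
    have h2 := hc 2 (j + 4 * k - if k % 3 = 0 then 1 else 0) (by omega)
    have hj : j % 3 = 0 ∨ j % 3 = 1 ∨ j % 3 = 2 := by omega
    have hk : k % 3 = 0 ∨ k % 3 = 1 ∨ k % 3 = 2 := by omega
    interval_cases s <;> rcases hj with hj | hj | hj <;> rcases hk with hk | hk | hk <;>
      simp only [hk] at h0 h1 h2 <;> grind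
  rcases lt_or_ge x k with hxk | hxk
  · obtain ⟨r, h, hr, hs, hh⟩ := key (2 * (k - 1 - x))
    exact ⟨r, k - 1 - x, 0, h, hr, by omega, by omega, hs, by omega, by omega⟩
  · obtain ⟨r, h, hr, hs, hh⟩ := key (2 * (2 * k - 1 - x) + 1)
    exact ⟨r, 2 * k - 1 - x, 1, h, hr, by omega, by omega, hs, by omega, by omega⟩

theorem bookLabel_bounds {k s x r m e h : ℕ} (hp : IsBookPosition k s x r m e h) :
    0 ≤ bookLabel k r m e h ∧ bookLabel k r m e h ≤ 6 * k ^ 2 + 2 * k := by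
  obtain ⟨hr, hm, he, -, -, hh⟩ := hp
  have h0 : (0 : ℤ) ≤ m * (2 * k - 1) := mul_nonneg (by omega) (by omega)
  have h1 : (m : ℤ) * (2 * k - 1) ≤ (k - 1) * (2 * k - 1) :=
    mul_le_mul_of_nonneg_right (by omega) (by omega)
  have h2 : ((k : ℤ) - 1) * (2 * k - 1) = 2 * (k * k) - 3 * k + 1 := by ring
  have hk : (0 : ℤ) ≤ k * k := by positivity
  rw [h2] at h1
  unfold bookLabel
  rw [sq]
  generalize (m : ℤ) * (2 * k - 1) = X at *
  generalize (k : ℤ) * k = A at *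
  interval_cases r <;> interval_cases e <;> constructor <;> push_cast <;> split_ifs at hh <;> omega

theorem layer_gap {h h' : ℕ} (hlt : h < h') :
    2 ≤ ((h' : ℤ) - (h' + 1) / 3) - (h - (h + 1) / 3) + starDist (h % 3) (h' % 3) := by
  unfold starDist
  split_ifs <;> omega

theorem column_gap_of_same_round {k x m e x' m' e' : ℕ} (hm' : m' < k) (he : e < 2)
    (he' : e' < 2) (hx : x + m + 1 = k + k * e) (hx' : x' + m' + 1 = k + k * e')
    (hlt : 2 * m + e < 2 * m' + e') :
    2 * (k : ℤ) ≤ (m' - m) * (2 * k - 1) + k * (e' - e) + ((x - x') + (x' - x) : ℕ) := by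
  have hsame : m = m' ∧ ((m' : ℤ) - m) * (2 * k - 1) = 0 ∨
      m + 1 = m' ∧ ((m' : ℤ) - m) * (2 * k - 1) = 2 * k - 1 ∨
      m + 2 ≤ m' ∧ 4 * (k : ℤ) - 2 ≤ ((m' : ℤ) - m) * (2 * k - 1) := by
    rcases lt_trichotomy m m' with hlt' | rfl | hlt'
    · rcases Nat.eq_or_lt_of_le hlt' with rfl | h2
      · right; left; refine ⟨rfl, ?_⟩; push_cast; ring
      · right; right; refine ⟨h2, ?_⟩; nlinarith
    · left; refine ⟨rfl, ?_⟩; ring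
    · omega
  generalize ((m' : ℤ) - m) * (2 * k - 1) = X at *
  interval_cases e <;> interval_cases e' <;> omega

theorem column_gap_of_next_round {k x m e x' m' e' : ℕ} (hm : m < k) (he : e < 2)
    (he' : e' < 2) (hx : x + m + 1 = k + k * e) (hx' : x' + m' + 1 = k + k * e') :
    2 * (k : ℤ) ≤ 2 * (k * k) + (m' - m) * (2 * k - 1) + k * (e' - e) +
      ((x - x') + (x' - x) : ℕ) := by
  have hnext : m + 1 = k ∧ m' = 0 ∧
        ((m' : ℤ) - m) * (2 * k - 1) = 3 * k - 1 - 2 * (k * k) ∨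
      (m + 1 < k ∨ 0 < m') ∧ 5 * (k : ℤ) - 2 - 2 * (k * k) ≤ ((m' : ℤ) - m) * (2 * k - 1) := by
    by_cases h0 : m + 1 = k ∧ m' = 0
    · obtain ⟨rfl, rfl⟩ := h0
      left; refine ⟨rfl, rfl, ?_⟩; push_cast; ring
    · right; refine ⟨by omega, ?_⟩
      have : (1 : ℤ) ≤ k - 1 - m + m' := by omega
      nlinarith
  generalize ((m' : ℤ) - m) * (2 * k - 1) = X at *
  generalize (k : ℤ) * k = A at *
  interval_cases e <;> interval_cases e' <;> omega

theorem bookLabel_gap {k s x r m e h s' x' r' m' e' h' : ℕ}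
    (hp : IsBookPosition k s x r m e h) (hp' : IsBookPosition k s' x' r' m' e' h')
    (hlt : r < r' ∨ r = r' ∧ 2 * m + e < 2 * m' + e') :
    2 * (k : ℤ) + 2 - (starDist s s' + ((x - x') + (x' - x)) : ℕ) ≤
      bookLabel k r' m' e' h' - bookLabel k r m e h := by
  obtain ⟨hr, hm, he, rfl, hx, hh⟩ := hp
  obtain ⟨hr', hm', he', rfl, hx', hh'⟩ := hp'
  have hlab : bookLabel k r' m' e' h' - bookLabel k r m e h =
      2 * (k * k) * (r' - r) + ((m' : ℤ) - m) * (2 * k - 1) + k * (e' - e) +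
        ((h' - (h' + 1) / 3) - (h - (h + 1) / 3)) := by
    unfold bookLabel; ring
  rw [hlab]
  clear hlab
  have hlayer : h < h' ∨ k % 3 = 0 ∧ r = 0 ∧ r' = 1 ∧ m + 1 = k ∧ m' = 0 ∧
      (e = 1 ∧ e' = 0 ∧ h' + 1 = h ∨ e = e' ∧ h = h') := by
    interval_cases r <;> interval_cases r' <;> split_ifs at hh hh' <;> omega
  rcases hlayer with hlayer | ⟨hk3, rfl, rfl, rfl, rfl, hcase⟩
  · have h1 := layer_gap hlayer
    have h2 : 2 * (k : ℤ) ≤ 2 * (k * k) * (r' - r) + (m' - m) * (2 * k - 1) + k * (e' - e) +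
        ((x - x') + (x' - x) : ℕ) := by
      rcases hlt with hlt | ⟨rfl, hlt⟩
      · have h3 := column_gap_of_next_round hm he he' hx hx'
        have h4 : (1 : ℤ) ≤ r' - r := by omega
        have h5 : (0 : ℤ) ≤ k * k := by positivity
        nlinarith
      · have h3 := column_gap_of_same_round hm' he he' hx hx' hlt
        rw [sub_self, mul_zero, zero_add]
        exact h3
    push_cast at h1 h2 ⊢
    linarith
  · have hX : 2 * (((m + 1 : ℕ) : ℤ) * (m + 1 : ℕ)) * ((1 : ℕ) - (0 : ℕ)) +
        ((0 : ℕ) - m) * (2 * (m + 1 : ℕ) - 1) = 3 * m + 2 := by push_cast; ring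
    rw [hX]
    rw [if_pos hk3] at hh
    rcases hcase with ⟨rfl, rfl, rfl⟩ | ⟨rfl, rfl⟩
    · have hs : starDist ((h' + 1) % 3) (h' % 3) = 2 := by
        unfold starDist; split_ifs at * <;> omega
      rw [hs]
      omega
    · rw [sub_self, mul_zero, sub_self]
      omega

theorem exists_isRadioLabeling_span_le {k : ℕ} (hk : 1 ≤ k) :
    ∃ f : Fin 3 × Fin (k + k) → ℕ,
      IsRadioLabeling (bookGraph 3 (k + k)) (k + k + 1) f ∧ span f ≤ 6 * k ^ 2 + 2 * k := by
  choose r m e h hp using fun v : Fin 3 × Fin (k + k) => exists_isBookPosition v.1.2 v.2.2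
  have hcast (v) : ((bookLabel k (r v) (m v) (e v) (h v)).toNat : ℤ) =
      bookLabel k (r v) (m v) (e v) (h v) := Int.toNat_of_nonneg (bookLabel_bounds (hp v)).1
  refine ⟨fun v => (bookLabel k (r v) (m v) (e v) (h v)).toNat, ?_, ?_⟩
  · intro u v huv
    have hpos : (r u < r v ∨ r u = r v ∧ 2 * m u + e u < 2 * m v + e v) ∨
        (r v < r u ∨ r v = r u ∧ 2 * m v + e v < 2 * m u + e u) := by
      by_contra! hc
      have hr : r u = r v := by omega
      have hu := hp u
      have hv := hp v
      have he : e u = e v := by unfold IsBookPosition at hu hv; omega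
      have hm : m u = m v := by omega
      simp only [IsBookPosition, hr, hm, he] at hu hv
      exact huv (Prod.ext (Fin.ext (by omega)) (Fin.ext (by omega)))
    simp only [hcast, bookGraph_dist, bookDist]
    rcases hpos with hlt | hlt
    · have := bookLabel_gap (hp u) (hp v) hlt
      rw [abs_sub_comm]
      refine le_trans (le_of_eq ?_) (this.trans (le_abs_self _))
      push_cast; ring
    · have := bookLabel_gap (hp v) (hp u) hlt
      refine le_trans (le_of_eq ?_) (this.trans (le_abs_self _))
      have hs : starDist u.1 v.1 = starDist v.1 u.1 := by
        simp only [starDist]; split_ifs <;> omega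
      rw [hs]
      push_cast; ring
  · have : Nonempty (Fin 3 × Fin (k + k)) := ⟨(0, ⟨0, by omega⟩)⟩
    refine span_le _ _ fun v => ?_
    have := (bookLabel_bounds (hp v)).2
    rw [← hcast] at this
    exact_mod_cast this

theorem rnBook_three_bounds (n : ℕ) (hn : Even n) (hn2 : 2 ≤ n) :
    3 * n ^ 2 / 2 + n - 1 ≤ rnBook 3 n ∧ rnBook 3 n ≤ 3 * n ^ 2 / 2 + n := by
  obtain ⟨k, rfl⟩ := hn
  have hk : 1 ≤ k := by omega
  obtain ⟨f, hf, hspan⟩ := exists_isRadioLabeling_span_le hk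
  have hsq : 3 * (k + k) ^ 2 / 2 = 6 * k ^ 2 := by
    rw [show 3 * (k + k) ^ 2 = 2 * (6 * k ^ 2) by ring]; simp
  have hlin : 6 * k ^ 2 + (k + k) = 6 * k ^ 2 + 2 * k := by ring
  rw [hsq, hlin]
  constructor
  · refine le_csInf ⟨_, f, hf, rfl⟩ ?_
    rintro _ ⟨g, hg, rfl⟩
    exact le_span_of_isRadioLabeling hk hg
  · exact le_trans (Nat.sInf_le (by exact ⟨f, hf, rfl⟩)) hspan
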